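/- arXiv:0803.1890 — 2 statements merged into one kernel-verified Lean document; each statement's English description precedes it below -/
import Mathlib

section
/- If 𝒴_s ≠ ∅, then for each i ∈ {1,…,d} the process S^i cannot revive from bankruptcy; that is, almost surely, S^i_t = 0 holds for all t ≥ ζ^{S^i} on the event {ζ^{S^i} < ∞}. -/
open MeasureTheory Set Filter
open scoped NNReal ENNReal Topology

noncomputable section

/-- A property of a path: right-continuous with left limits (càdlàg). -/
def IsCadlag {E : Type*} [TopologicalSpace E] (f : ℝ≥0 → E) : Prop :=
  (∀ t : ℝ≥0, ContinuousWithinAt f (Set.Ici t) t) ∧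
    ∀ t : ℝ≥0, 0 < t → ∃ l : E, Filter.Tendsto f (nhdsWithin t (Set.Iio t)) (nhds l)

/-- The `d`-dimensional simplex. -/
def stdSimplexSet (d : ℕ) : Set (Fin d → ℝ) :=
  {z | (∀ i, 0 ≤ z i) ∧ ∑ i, z i ≤ 1}

variable {Ω : Type*} {m : MeasurableSpace Ω}

/-- A simple predictable strategy: finitely many trading times `τ 0 = 0 ≤ τ 1 ≤ … ≤ τ n`
(finite stopping times), where the (random) vector `ϑ j` of numbers of units of the `d` assets
held on the interval `(τ j, τ (j+1)]` is `ℱ_{τ j}`-measurable. -/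
structure SimpleStrategy (ℱ : MeasureTheory.Filtration ℝ≥0 m) (d : ℕ) where
  n : ℕ
  τ : ℕ → Ω → ℝ≥0
  ϑ : ℕ → Ω → Fin d → ℝ
  τ_zero : ∀ ω, τ 0 ω = 0
  τ_mono : ∀ j, ∀ ω, τ j ω ≤ τ (j + 1) ω
  τ_stopping : ∀ j, MeasureTheory.IsStoppingTime ℱ (fun ω => (τ j ω : WithTop ℝ≥0))
  ϑ_meas : ∀ j, Measurable[(τ_stopping j).measurableSpace] (ϑ j)

namespace SimpleStrategy

variable {ℱ : MeasureTheory.Filtration ℝ≥0 m} {d : ℕ}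

/-- The wealth process `X^{x,θ}` associated with initial capital `x` and simple strategy `θ`. -/
def wealth (θ : SimpleStrategy ℱ d) (S : ℝ≥0 → Ω → Fin d → ℝ) (x : ℝ) (t : ℝ≥0) (ω : Ω) : ℝ :=
  x + ∑ j ∈ Finset.range θ.n, ∑ i, θ.ϑ j ω i *
    (S (min (θ.τ (j + 1) ω) t) ω i - S (min (θ.τ j ω) t) ω i)

/-- No-short-sales admissibility: all holdings are nonnegative, and the value of the held
assets never exceeds current wealth. -/
def Admissible (θ : SimpleStrategy ℱ d) (P : MeasureTheory.Measure Ω)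
    (S : ℝ≥0 → Ω → Fin d → ℝ) (x : ℝ) : Prop :=
  ∀ j < θ.n, ∀ᵐ ω ∂P, (∀ i, 0 ≤ θ.ϑ j ω i) ∧
    ∑ i, θ.ϑ j ω i * S (θ.τ j ω) ω i ≤ θ.wealth S x (θ.τ j ω) ω

end SimpleStrategy

/-- `𝒳_s(x)`: wealth processes of simple, no-short-sales strategies with initial capital `x`. -/
def Xs (P : MeasureTheory.Measure Ω) (ℱ : MeasureTheory.Filtration ℝ≥0 m) {d : ℕ}
    (S : ℝ≥0 → Ω → Fin d → ℝ) (x : ℝ) : Set (ℝ≥0 → Ω → ℝ) :=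
  {X | ∃ θ : SimpleStrategy ℱ d, θ.Admissible P S x ∧ X = θ.wealth S x}

/-- `𝒳_s = ⋃_{x ≥ 0} 𝒳_s(x)`. -/
def XsAll (P : MeasureTheory.Measure Ω) (ℱ : MeasureTheory.Filtration ℝ≥0 m) {d : ℕ}
    (S : ℝ≥0 → Ω → Fin d → ℝ) : Set (ℝ≥0 → Ω → ℝ) :=
  {X | ∃ x : ℝ, 0 ≤ x ∧ X ∈ Xs P ℱ S x}

/-- `ξ` is an arbitrage of the first kind on `[0, T]`. -/
def ArbitrageOfFirstKind (P : MeasureTheory.Measure Ω) (ℱ : MeasureTheory.Filtration ℝ≥0 m)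
    {d : ℕ} (S : ℝ≥0 → Ω → Fin d → ℝ) (T : ℝ≥0) (ξ : Ω → ℝ) : Prop :=
  Measurable[ℱ T] ξ ∧ (∀ᵐ ω ∂P, 0 ≤ ξ ω) ∧ 0 < P {ω | 0 < ξ ω} ∧
    ∀ x : ℝ, 0 < x → ∃ X ∈ Xs P ℱ S x, ∀ᵐ ω ∂P, ξ ω ≤ X T ω

/-- Condition NA1_s: no arbitrage of the first kind on any interval `[0, T]`. -/
def NA1s (P : MeasureTheory.Measure Ω) (ℱ : MeasureTheory.Filtration ℝ≥0 m) {d : ℕ}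
    (S : ℝ≥0 → Ω → Fin d → ℝ) : Prop :=
  ∀ (T : ℝ≥0) (ξ : Ω → ℝ), ¬ ArbitrageOfFirstKind P ℱ S T ξ

/-- A set of random variables is bounded in probability. -/
def BddInProb (P : MeasureTheory.Measure Ω) (C : Set (Ω → ℝ)) : Prop :=
  Filter.Tendsto (fun ℓ : ℝ => ⨆ f ∈ C, P {ω | ℓ < |f ω|}) Filter.atTop (nhds 0)

/-- The filtration is right-continuous. -/
def RightContinuousFiltration (ℱ : MeasureTheory.Filtration ℝ≥0 m) : Prop :=
  ∀ t : ℝ≥0, (ℱ t : MeasurableSpace Ω) = ⨅ (u : ℝ≥0) (_ : t < u), ℱ u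

/-- `ℱ 0` (hence every `ℱ t`) contains all `P`-null sets. -/
def CompleteFiltration (ℱ : MeasureTheory.Filtration ℝ≥0 m) (P : MeasureTheory.Measure Ω) : Prop :=
  ∀ N : Set Ω, MeasurableSet N → P N = 0 → MeasurableSet[ℱ 0] N

/-- The (first) bankruptcy time `ζ^X` of a process `X`, valued in `ℝ≥0∞`. -/
def bankruptcyTime (X : ℝ≥0 → Ω → ℝ) (ω : Ω) : ℝ≥0∞ :=
  sInf ((fun t : ℝ≥0 => (t : ℝ≥0∞)) ''
    {t : ℝ≥0 | Function.leftLim (fun s => X s ω) t = 0 ∨ X t ω = 0})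

/-- `X` cannot revive from bankruptcy: a.s., `X_t = 0` for all `t ≥ ζ^X` on `{ζ^X < ∞}`. -/
def CannotRevive (P : MeasureTheory.Measure Ω) (X : ℝ≥0 → Ω → ℝ) : Prop :=
  ∀ᵐ ω ∂P, ∀ t : ℝ≥0, bankruptcyTime X ω ≤ (t : ℝ≥0∞) → X t ω = 0

/-- `𝒴_s`: strictly positive supermartingale deflators for simple, no-short-sales trading. -/
def Ys (P : MeasureTheory.Measure Ω) (ℱ : MeasureTheory.Filtration ℝ≥0 m) {d : ℕ}
    (S : ℝ≥0 → Ω → Fin d → ℝ) : Set (ℝ≥0 → Ω → ℝ) :=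
  {Y | MeasureTheory.StronglyAdapted ℱ Y ∧ (∀ ω, IsCadlag (fun t => Y t ω)) ∧
    (∀ᵐ ω ∂P, Y 0 ω = 1 ∧ ∀ t : ℝ≥0, 0 < Y t ω) ∧
    ∀ X ∈ XsAll P ℱ S, MeasureTheory.Supermartingale (fun t ω => Y t ω * X t ω) ℱ P}

/-- Finite maximal-type inequality for supermartingales. -/
theorem superm_finset_bound {Ω : Type*} {m : MeasurableSpace Ω} (P : Measure Ω)
    [IsProbabilityMeasure P] (ℱ : Filtration ℝ≥0 m) (Z : ℝ≥0 → Ω → ℝ)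
    (hZ : Supermartingale Z ℱ P) (t : ℝ≥0) (ε : ℝ) (D : Finset ℝ≥0) (hD : ∀ s ∈ D, s ≤ t) :
    (∫ ω in ⋃ s ∈ D, {ω | Z s ω < ε}, Z t ω ∂P) ≤ ε * P.real (⋃ s ∈ D, {ω | Z s ω < ε}) := by
  have hm : ∀ s, MeasurableSet[ℱ s] {ω | Z s ω < ε} := fun s =>
    (hZ.1 s).measurable measurableSet_Iio
  induction D using Finset.induction_on_max with
  | empty => simp
  | insert a D ha ih =>
    have ih' := ih (fun s hs => hD s (Finset.mem_insert_of_mem hs))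
    set B := ⋃ s ∈ D, {ω | Z s ω < ε} with hB
    have hBm : MeasurableSet[ℱ a] B := by
      refine @Finset.measurableSet_biUnion _ _ (ℱ a) _ D fun s hs => ?_
      exact ℱ.mono (ha s hs).le _ (hm s)
    have hCm : MeasurableSet[ℱ a] ({ω | Z a ω < ε} \ B) := @MeasurableSet.diff _ (ℱ a) _ _ (hm a) hBm
    have hBm' := ℱ.le a _ hBm
    have hCm' := ℱ.le a _ hCm
    have hU : (⋃ s ∈ insert a D, {ω | Z s ω < ε}) = B ∪ ({ω | Z a ω < ε} \ B) := by
      rw [Finset.set_biUnion_insert, union_sdiff_self, union_comm]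
    have hdisj : Disjoint B ({ω | Z a ω < ε} \ B) := disjoint_sdiff_self_right
    rw [hU, setIntegral_union hdisj hCm' (hZ.integrable t).integrableOn
      (hZ.integrable t).integrableOn, measureReal_union hdisj hCm' (measure_ne_top P _)
      (measure_ne_top P _), mul_add]
    refine add_le_add ih' ?_
    refine (hZ.setIntegral_le (hD a (Finset.mem_insert_self _ _)) hCm).trans ?_
    have : ∫ ω in {ω | Z a ω < ε} \ B, Z a ω ∂P ≤ ∫ ω in {ω | Z a ω < ε} \ B, ε ∂P := by
      refine setIntegral_mono_on (hZ.integrable a).integrableOn (by simp) hCm' ?_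
      intro ω hω
      exact le_of_lt hω.1
    refine this.trans ?_
    rw [setIntegral_const, smul_eq_mul, mul_comm]

/-- A nonnegative supermartingale positive at `t` is bounded below on countably many earlier
times. -/
theorem superm_pos_bound {Ω : Type*} {m : MeasurableSpace Ω} (P : Measure Ω)
    [IsProbabilityMeasure P] (ℱ : Filtration ℝ≥0 m) (Z : ℝ≥0 → Ω → ℝ)
    (hZ : Supermartingale Z ℱ P) (hZ0 : ∀ᵐ ω ∂P, ∀ s, 0 ≤ Z s ω)
    (t : ℝ≥0) (q : ℕ → ℝ≥0) (hq : ∀ n, q n ≤ t) :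
    ∀ᵐ ω ∂P, 0 < Z t ω → ∃ c : ℝ, 0 < c ∧ ∀ n, c ≤ Z (q n) ω := by
  have hm : ∀ s ε, MeasurableSet {ω | Z s ω < ε} := fun s ε =>
    measurableSet_lt ((hZ.1 s).mono (ℱ.le s)).measurable measurable_const
  have hbd : ∀ ε : ℝ, 0 < ε → (∫ ω in ⋃ n, {ω | Z (q n) ω < ε}, Z t ω ∂P) ≤ ε := by
    intro ε hε
    let s : ℕ → Set Ω := fun N => ⋃ u ∈ (Finset.range N).image q, {ω | Z u ω < ε}
    have hs : (⋃ n, {ω | Z (q n) ω < ε}) = ⋃ N, s N := by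
      ext ω
      simp only [s, mem_iUnion, Finset.mem_image, Finset.mem_range, mem_ofPred_eq]
      constructor
      · rintro ⟨n, hn⟩
        exact ⟨n + 1, q n, ⟨n, by omega, rfl⟩, hn⟩
      · rintro ⟨N, u, ⟨n, _, rfl⟩, h⟩
        exact ⟨n, h⟩
    rw [hs]
    refine le_of_tendsto (tendsto_setIntegral_of_monotone (s := s) ?_ ?_
      (hZ.integrable t).integrableOn) (Eventually.of_forall fun N => ?_)
    · intro N
      exact Finset.measurableSet_biUnion _ fun u _ => hm u ε
    · intro M N hMN
      refine biUnion_subset_biUnion_left ?_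
      intro u hu
      exact Finset.image_subset_image (Finset.range_subset_range.2 hMN) hu
    · refine (superm_finset_bound P ℱ Z hZ t ε _ ?_).trans ?_
      · intro u hu
        obtain ⟨n, _, rfl⟩ := Finset.mem_image.1 hu
        exact hq n
      · exact mul_le_of_le_one_right hε.le measureReal_le_one
  set N : Set Ω := ⋂ k : ℕ, ⋃ n, {ω | Z (q n) ω < 1 / ((k : ℝ) + 1)} with hN
  have hNm : MeasurableSet N := MeasurableSet.iInter fun k => MeasurableSet.iUnion fun n => hm _ _
  have hZt : 0 ≤ᵐ[P] Z t := hZ0.mono fun ω h => h t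
  have hle : ∀ k : ℕ, (∫ ω in N, Z t ω ∂P) ≤ 1 / ((k : ℝ) + 1) := fun k =>
    (setIntegral_mono_set (hZ.integrable t).integrableOn (ae_restrict_of_ae hZt)
      (LE.le.eventuallyLE (iInter_subset _ k))).trans (hbd _ (by positivity))
  have h0 : (∫ ω in N, Z t ω ∂P) ≤ 0 :=
    ge_of_tendsto' tendsto_one_div_add_atTop_nhds_zero_nat hle
  have h1 : (∫ ω in N, Z t ω ∂P) = 0 :=
    le_antisymm h0 (integral_nonneg_of_ae (ae_restrict_of_ae hZt))
  rw [setIntegral_eq_zero_iff_of_nonneg_ae (ae_restrict_of_ae hZt)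
    (hZ.integrable t).integrableOn] at h1
  have h2 := (ae_restrict_iff' hNm).1 h1
  filter_upwards [h2] with ω hω hpos
  have hnot : ω ∉ N := fun h => hpos.ne' (hω h)
  simp only [hN, mem_iInter, mem_iUnion, mem_ofPred_eq, not_forall, not_exists, not_lt] at hnot
  obtain ⟨k, hk⟩ := hnot
  exact ⟨1 / ((k : ℝ) + 1), by positivity, hk⟩

/-- Buy and hold `h` units of asset `i` from time `0` to `T`. -/
def buyHold (ℱ : Filtration ℝ≥0 m) (d : ℕ) (i : Fin d) (T : ℝ≥0) (h : Ω → ℝ)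
    (hh : Measurable[ℱ 0] h) : SimpleStrategy ℱ d where
  n := 1
  τ := fun j _ => if j = 0 then 0 else T
  ϑ := fun j ω k => if j = 0 then (if k = i then h ω else 0) else 0
  τ_zero := by simp
  τ_mono := by intro j ω; by_cases hj : j = 0 <;> simp [hj]
  τ_stopping := fun j => isStoppingTime_const ℱ (if j = 0 then 0 else T)
  ϑ_meas := by
    intro j
    rw [IsStoppingTime.measurableSpace_const]
    by_cases hj : j = 0
    · subst hj
      simp only [if_true]
      refine @measurable_pi_lambda _ _ _ (ℱ 0) _ _ fun k => ?_
      by_cases hk : k = i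
      · simpa [hk] using hh
      · simp only [hk, if_false]; exact measurable_const
    · simp only [hj, if_false]; exact measurable_const

theorem buyHold_wealth (ℱ : Filtration ℝ≥0 m) (d : ℕ) (i : Fin d) (T : ℝ≥0) (h : Ω → ℝ)
    (hh : Measurable[ℱ 0] h) (S : ℝ≥0 → Ω → Fin d → ℝ) (x : ℝ) (t : ℝ≥0) (ω : Ω) :
    (buyHold ℱ d i T h hh).wealth S x t ω = x + h ω * (S (min T t) ω i - S 0 ω i) := by
  simp [SimpleStrategy.wealth, buyHold]

/-- Key consequence of a deflator for a buy-and-hold position. -/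
theorem buyHold_bound {Ω : Type*} {m : MeasurableSpace Ω} (P : Measure Ω)
    [IsProbabilityMeasure P] (ℱ : Filtration ℝ≥0 m) (d : ℕ) (S : ℝ≥0 → Ω → Fin d → ℝ)
    (hS_nonneg : ∀ t ω i, 0 ≤ S t ω i) (Y : ℝ≥0 → Ω → ℝ) (hY : Y ∈ Ys P ℱ S)
    (i : Fin d) (T : ℝ≥0) (x : ℝ) (hx : 0 ≤ x) (h : Ω → ℝ) (hh : Measurable[ℱ 0] h)
    (h0 : ∀ ω, 0 ≤ h ω) (hhx : ∀ ω, h ω * S 0 ω i ≤ x) (q : ℕ → ℝ≥0) (hq : ∀ n, q n ≤ T) :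
    ∀ᵐ ω ∂P, 0 < Y T ω * (x + h ω * (S T ω i - S 0 ω i)) → ∃ c : ℝ, 0 < c ∧
      ∀ n, c ≤ Y (q n) ω * (x + h ω * (S (q n) ω i - S 0 ω i)) := by
  obtain ⟨-, -, hYpos, hYs⟩ := hY
  have hX : (buyHold ℱ d i T h hh).wealth S x ∈ XsAll P ℱ S := by
    refine ⟨x, hx, buyHold ℱ d i T h hh, ?_, rfl⟩
    intro j hj
    have hj0 : j = 0 := by simpa [buyHold] using hj
    subst hj0
    refine Eventually.of_forall fun ω => ⟨fun k => ?_, ?_⟩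
    · by_cases hk : k = i <;> simp [buyHold, hk, h0]
    · rw [buyHold_wealth]
      simpa [buyHold] using hhx ω
  have hsm := hYs _ hX
  have hnn : ∀ᵐ ω ∂P, ∀ s, 0 ≤ Y s ω * (buyHold ℱ d i T h hh).wealth S x s ω := by
    filter_upwards [hYpos] with ω hω s
    refine mul_nonneg (hω.2 s).le ?_
    rw [buyHold_wealth]
    have := mul_nonneg (h0 ω) (hS_nonneg (min T s) ω i)
    have := hhx ω
    nlinarith
  filter_upwards [superm_pos_bound P ℱ _ hsm hnn T q hq] with ω hω hpos
  simp only [buyHold_wealth, min_self] at hω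
  obtain ⟨c, hc, hcn⟩ := hω hpos
  refine ⟨c, hc, fun n => ?_⟩
  have := hcn n
  rwa [min_eq_right (hq n)] at this

/-- **Theorem 2.3, (ii) ⇒ (iii), second half.** If `𝒴_s ≠ ∅` then each discounted asset price
`S^i` cannot revive from bankruptcy. -/
theorem deflator_implies_cannotRevive
    {Ω : Type*} {m : MeasurableSpace Ω} (P : MeasureTheory.Measure Ω)
    [MeasureTheory.IsProbabilityMeasure P] (ℱ : MeasureTheory.Filtration ℝ≥0 m)
    (hright : RightContinuousFiltration ℱ) (hcompl : CompleteFiltration ℱ P)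
    (d : ℕ) (S : ℝ≥0 → Ω → Fin d → ℝ)
    (hS_adapted : MeasureTheory.StronglyAdapted ℱ S)
    (hS_cadlag : ∀ ω, IsCadlag (fun t => S t ω))
    (hS_nonneg : ∀ t ω i, 0 ≤ S t ω i)
    (hY : Ys P ℱ S ≠ ∅) :
    ∀ i : Fin d, CannotRevive P (fun t ω => S t ω i) := by
  intro i
  obtain ⟨Y, hYmem⟩ := Set.nonempty_iff_ne_empty.2 hY
  have hYc := hYmem.2.1
  have hYpos := hYmem.2.2.1
  have hS0m : Measurable[ℱ 0] (fun ω => S 0 ω i) :=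
    (measurable_pi_apply i).comp (hS_adapted 0).measurable
  let D : ℕ → ℝ≥0 := TopologicalSpace.denseSeq ℝ≥0
  have hD : DenseRange D := TopologicalSpace.denseRange_denseSeq ℝ≥0
  have hDI : ∀ a b : ℝ≥0, a < b → ∃ n, a < D n ∧ D n < b := fun a b hab =>
    hD.exists_mem_open isOpen_Ioo (nonempty_Ioo.2 hab)
  have hinv : Measurable[ℱ 0] (fun ω => (S 0 ω i)⁻¹) := hS0m.inv
  have hind : Measurable[ℱ 0] (fun ω => if S 0 ω i = 0 then (1 : ℝ) else 0) := by
    exact Measurable.ite (m := ℱ 0) (hS0m (measurableSet_singleton 0)) measurable_const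
      measurable_const
  have hA : ∀ᵐ ω ∂P, ∀ k, 0 < Y (D k) ω * (1 + (S 0 ω i)⁻¹ * (S (D k) ω i - S 0 ω i)) →
      ∃ c : ℝ, 0 < c ∧ ∀ n, c ≤ Y (min (D n) (D k)) ω *
        (1 + (S 0 ω i)⁻¹ * (S (min (D n) (D k)) ω i - S 0 ω i)) := by
    rw [ae_all_iff]
    intro k
    exact buyHold_bound P ℱ d S hS_nonneg Y hYmem i (D k) 1 zero_le_one _ hinv
      (fun ω => inv_nonneg.2 (hS_nonneg 0 ω i)) (fun ω => inv_mul_le_one) _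
      (fun n => min_le_right _ _)
  have hB : ∀ᵐ ω ∂P, ∀ k, 0 < Y (D k) ω *
      (0 + (if S 0 ω i = 0 then (1 : ℝ) else 0) * (S (D k) ω i - S 0 ω i)) →
      ∃ c : ℝ, 0 < c ∧ ∀ _n : ℕ, c ≤ Y 0 ω *
        (0 + (if S 0 ω i = 0 then (1 : ℝ) else 0) * (S 0 ω i - S 0 ω i)) := by
    rw [ae_all_iff]
    intro k
    refine buyHold_bound P ℱ d S hS_nonneg Y hYmem i (D k) 0 le_rfl _ hind
      (fun ω => by split_ifs <;> norm_num) (fun ω => ?_) (fun _ => 0) (fun n => zero_le)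
    split_ifs with h <;> simp [h]
  filter_upwards [hA, hB, hYpos] with ω hAω hBω hYω t ht
  have hScad : ∀ u, ContinuousWithinAt (fun s => S s ω i) (Set.Ici u) u := fun u =>
    (continuous_apply i).continuousAt.comp_continuousWithinAt ((hS_cadlag ω).1 u)
  have hSnn : ∀ s, 0 ≤ S s ω i := fun s => hS_nonneg s ω i
  -- from right-eventual properties to dense times
  have hright' : ∀ (u v : ℝ≥0) (p : ℝ≥0 → Prop), u < v → (∀ᶠ s in 𝓝[≥] u, p s) →
      ∃ n, D n < v ∧ u < D n ∧ p (D n) := by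
    intro u v p huv hp
    obtain ⟨w, hw, hsub⟩ := (mem_nhdsGE_iff_exists_Ico_subset' huv).1 hp
    obtain ⟨n, hn1, hn2⟩ := hDI u (min w v) (lt_min hw huv)
    exact ⟨n, hn2.trans_le (min_le_right _ _), hn1,
      hsub ⟨hn1.le, hn2.trans_le (min_le_left _ _)⟩⟩
  by_contra hne
  have hpos : 0 < S t ω i := lt_of_le_of_ne (hSnn t) (Ne.symm hne)
  obtain ⟨k, -, htk, hkpos⟩ := hright' t (t + 1) (fun s => 0 < S s ω i)
    (lt_add_of_pos_right t one_pos) ((hScad t).eventually (lt_mem_nhds hpos))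
  have hYk := hYω.2 (D k)
  have hS0 : S 0 ω i ≠ 0 := by
    intro h0
    obtain ⟨c, hc, hcn⟩ := hBω k (by simpa [h0] using mul_pos hYk hkpos)
    have := hcn 0
    simp at this
    linarith
  have hS0pos : 0 < S 0 ω i := lt_of_le_of_ne (hSnn 0) (Ne.symm hS0)
  have hfm : ∀ s, Y s ω * (1 + (S 0 ω i)⁻¹ * (S s ω i - S 0 ω i))
      = (S 0 ω i)⁻¹ * (Y s ω * S s ω i) := by
    intro s; field_simp; ring
  obtain ⟨c, hc, hcn⟩ := hAω k (by
    rw [hfm]; exact mul_pos (inv_pos.2 hS0pos) (mul_pos hYk hkpos))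
  have hlow : ∀ n, D n < D k → c ≤ (S 0 ω i)⁻¹ * (Y (D n) ω * S (D n) ω i) := by
    intro n hn
    have := hcn n
    rwa [hfm, min_eq_left hn.le] at this
  have hlt : bankruptcyTime (fun t ω => S t ω i) ω < (D k : ℝ≥0∞) :=
    lt_of_le_of_lt ht (ENNReal.coe_lt_coe.2 htk)
  obtain ⟨_, ⟨u, hu, rfl⟩, huk⟩ := sInf_lt_iff.1 hlt
  have huk : u < D k := ENNReal.coe_lt_coe.1 huk
  have hzero : S u ω i ≠ 0 := by
    intro h0
    have hcont : ContinuousWithinAt (fun s => (S 0 ω i)⁻¹ * (Y s ω * S s ω i)) (Set.Ici u) u :=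
      continuousWithinAt_const.mul (((hYc ω).1 u).mul (hScad u))
    obtain ⟨n, hn, -, hlt⟩ := hright' u (D k)
      (fun s => (S 0 ω i)⁻¹ * (Y s ω * S s ω i) < c) huk
      (hcont.eventually (gt_mem_nhds (by simpa [h0] using hc)))
    exact absurd (hlow n hn) (not_le.2 hlt)
  have hu' : Function.leftLim (fun s => S s ω i) u = 0 := hu.resolve_right hzero
  rcases eq_or_lt_of_le (zero_le (a := u)) with hu0 | hu0
  · rw [leftLim_eq_of_isBot (fun b => by rw [← hu0]; exact zero_le)] at hu'
    exact hzero hu'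
  · obtain ⟨l, hl⟩ := (hS_cadlag ω).2 u hu0
    obtain ⟨y, hy⟩ := (hYc ω).2 u hu0
    have hl' : Tendsto (fun s => S s ω i) (𝓝[<] u) (𝓝 (l i)) :=
      ((continuous_apply i).tendsto l).comp hl
    have : (𝓝[<] u).NeBot := nhdsLT_neBot_of_exists_lt ⟨0, hu0⟩
    rw [leftLim_eq_of_tendsto hl'] at hu'
    have hlim : Tendsto (fun s => (S 0 ω i)⁻¹ * (Y s ω * S s ω i)) (𝓝[<] u)
        (𝓝 ((S 0 ω i)⁻¹ * (y * l i))) := tendsto_const_nhds.mul (hy.mul hl')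
    have hev := hlim.eventually_lt_const (u := c) (by simpa [hu'] using hc)
    obtain ⟨w, hw, hsub⟩ := (mem_nhdsLT_iff_exists_Ioo_subset' hu0).1 hev
    obtain ⟨n, hn1, hn2⟩ := hDI w u hw
    exact absurd (hlow n (hn2.trans huk)) (not_le.2 (hsub ⟨hn1, hn2⟩))

end
end

section
/- Let U : [0,∞) → ℝ ∪ {−∞} be nondecreasing with U(y) > −∞ for all y > 0 and lim_{y→∞} U(y) = ∞. Fix x > 0 and a finite stopping time T. If sup_{X ∈ 𝒳_s(x)} E[U(X_T)] < ∞ (expectations taking values in [−∞,∞]), then the set {X_T : X ∈ 𝒳_s(x)} is bounded in probability. -/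
open MeasureTheory Set Filter
open scoped NNReal ENNReal Topology

noncomputable section

variable {Ω : Type*} {m : MeasurableSpace Ω}

/-- Auxiliary: the nonnegative part of an extended real, valued in `ℝ≥0∞`. -/
def erealPosPart (x : EReal) : ℝ≥0∞ := if x = ⊤ then ⊤ else ENNReal.ofReal x.toReal

/-- The extended expectation `E[g] ∈ [−∞, ∞]` of an `EReal`-valued random variable, with the
convention that it equals `−∞` whenever the negative part fails to be integrable. -/
def extExp {Ω : Type*} [MeasurableSpace Ω] (P : MeasureTheory.Measure Ω) (g : Ω → EReal) :
    EReal :=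
  ((∫⁻ ω, erealPosPart (g ω) ∂P : ℝ≥0∞) : EReal) -
    ((∫⁻ ω, erealPosPart (-(g ω)) ∂P : ℝ≥0∞) : EReal)

/-- Evaluation of a right-continuous measurable process at a measurable time is measurable. -/
lemma measurable_eval_time {d : ℕ} (S : ℝ≥0 → Ω → Fin d → ℝ)
    (hS : ∀ t, Measurable (S t))
    (hS_cadlag : ∀ ω, IsCadlag (fun t => S t ω)) (σ : Ω → ℝ≥0) (hσ : Measurable σ) :
    Measurable (fun ω => S (σ ω) ω) := by
  let k : ℕ → Ω → ℕ := fun n ω => ⌊((n : ℝ≥0) + 1) * σ ω⌋₊ + 1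
  let g : ℕ → Ω → ℝ≥0 := fun n ω => (k n ω : ℝ≥0) / ((n : ℝ≥0) + 1)
  have hk : ∀ n, Measurable (k n) := by
    intro n
    exact (Nat.measurable_floor.comp (hσ.const_mul _)).add_const 1
  have hge : ∀ n ω, σ ω ≤ g n ω := by
    intro n ω
    have hn : (0 : ℝ≥0) < (n : ℝ≥0) + 1 := by positivity
    show σ ω ≤ (k n ω : ℝ≥0) / ((n : ℝ≥0) + 1)
    rw [le_div_iff₀ hn, mul_comm]
    have := (Nat.lt_floor_add_one (((n : ℝ≥0) + 1) * σ ω)).le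
    simpa [k] using this
  have hle : ∀ n ω, g n ω ≤ σ ω + 1 / ((n : ℝ≥0) + 1) := by
    intro n ω
    have hn : (0 : ℝ≥0) < (n : ℝ≥0) + 1 := by positivity
    show (k n ω : ℝ≥0) / ((n : ℝ≥0) + 1) ≤ _
    rw [div_le_iff₀ hn, add_mul, one_div, inv_mul_cancel₀ hn.ne']
    have h := Nat.floor_le (zero_le (a := ((n : ℝ≥0) + 1) * σ ω))
    have h2 : ((k n ω : ℕ) : ℝ≥0) = (⌊((n : ℝ≥0) + 1) * σ ω⌋₊ : ℝ≥0) + 1 := by simp [k]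
    rw [h2, mul_comm (σ ω)]
    gcongr
  have hlim : ∀ ω, Tendsto (fun n => g n ω) atTop (𝓝 (σ ω)) := by
    intro ω
    refine tendsto_of_tendsto_of_tendsto_of_le_of_le tendsto_const_nhds ?_
      (fun n => hge n ω) (fun n => hle n ω)
    have h := (tendsto_one_div_add_atTop_nhds_zero_nat (𝕜 := ℝ≥0)).const_add (σ ω)
    simpa using h
  refine measurable_of_tendsto_metrizable (f := fun n ω => S (g n ω) ω) ?_ ?_
  · intro n
    have : Measurable (fun p : ℕ × Ω => S ((p.1 : ℝ≥0) / ((n : ℝ≥0) + 1)) p.2) :=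
      measurable_from_prod_countable_right (fun q => hS ((q : ℝ≥0) / ((n : ℝ≥0) + 1)))
    exact this.comp ((hk n).prodMk measurable_id)
  · rw [tendsto_pi_nhds]
    intro ω
    have hc := (hS_cadlag ω).1 (σ ω)
    exact hc.tendsto.comp (tendsto_nhdsWithin_iff.2
      ⟨hlim ω, Eventually.of_forall (fun n => hge n ω)⟩)

lemma measurable_of_stopping {ℱ : MeasureTheory.Filtration ℝ≥0 m} (T : Ω → ℝ≥0)
    (hT : MeasureTheory.IsStoppingTime ℱ (fun ω => (T ω : WithTop ℝ≥0))) : Measurable T := by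
  refine measurable_of_Iic (fun t => ?_)
  have h := ℱ.le t _ (hT t)
  have e : T ⁻¹' Iic t = {ω | ((T ω : WithTop ℝ≥0)) ≤ t} := by
    ext ω; exact (WithTop.coe_le_coe (a := t) (b := T ω)).symm
  rw [e]; exact h

lemma wealth_measurable {ℱ : MeasureTheory.Filtration ℝ≥0 m} {d : ℕ}
    (θ : SimpleStrategy ℱ d) (S : ℝ≥0 → Ω → Fin d → ℝ)
    (hS : ∀ t, Measurable (S t))
    (hS_cadlag : ∀ ω, IsCadlag (fun t => S t ω)) (x : ℝ) (T : Ω → ℝ≥0) (hT : Measurable T) :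
    Measurable (fun ω => θ.wealth S x (T ω) ω) := by
  have hτ : ∀ j, Measurable (θ.τ j) := fun j => measurable_of_stopping _ (θ.τ_stopping j)
  have hϑ : ∀ j, Measurable (θ.ϑ j) :=
    fun j => (θ.ϑ_meas j).mono (θ.τ_stopping j).measurableSpace_le le_rfl
  have hE : ∀ j, Measurable (fun ω => S (min (θ.τ j ω) (T ω)) ω) :=
    fun j => measurable_eval_time S hS hS_cadlag _ ((hτ j).min hT)
  unfold SimpleStrategy.wealth
  refine measurable_const.add (Finset.measurable_sum _ fun j _ => Finset.measurable_sum _ fun i _ => ?_)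
  exact (measurable_pi_iff.1 (hϑ j) i).mul
    ((measurable_pi_iff.1 (hE (j+1)) i).sub (measurable_pi_iff.1 (hE j) i))

/-- Pathwise nonnegativity of wealth. -/
lemma wealth_nonneg_path {d : ℕ} (n : ℕ) (τ : ℕ → ℝ≥0) (hτ : Monotone τ)
    (ϑ : ℕ → Fin d → ℝ) (s : ℝ≥0 → Fin d → ℝ) (hs : ∀ t i, 0 ≤ s t i) (x : ℝ) (hx : 0 ≤ x)
    (h0 : ∀ j < n, ∀ i, 0 ≤ ϑ j i)
    (hadm : ∀ j < n, ∑ i, ϑ j i * s (τ j) i ≤ x + ∑ l ∈ Finset.range n, ∑ i, ϑ l i *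
      (s (min (τ (l + 1)) (τ j)) i - s (min (τ l) (τ j)) i)) (k : ℕ) (hk : k ≤ n) (t : ℝ≥0) :
    0 ≤ x + ∑ l ∈ Finset.range k, ∑ i, ϑ l i *
      (s (min (τ (l + 1)) t) i - s (min (τ l) t) i) := by
  induction k with
  | zero => simpa using hx
  | succ k ih =>
    have hkn : k < n := hk
    specialize ih hkn.le
    rw [Finset.sum_range_succ]
    rcases le_total t (τ k) with ht | ht
    · have e1 : min (τ (k+1)) t = t := min_eq_right (ht.trans (hτ (Nat.le_succ k)))
      have e2 : min (τ k) t = t := min_eq_right ht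
      simp only [e1, e2, sub_self, mul_zero, Finset.sum_const_zero, add_zero]
      exact ih
    · have h := hadm k hkn
      have e : ∑ l ∈ Finset.range n, ∑ i, ϑ l i *
          (s (min (τ (l + 1)) (τ k)) i - s (min (τ l) (τ k)) i)
          = ∑ l ∈ Finset.range k, ∑ i, ϑ l i *
          (s (min (τ (l + 1)) t) i - s (min (τ l) t) i) := by
        rw [← Finset.sum_subset (Finset.range_mono hkn.le)]
        · refine Finset.sum_congr rfl fun l hl => ?_
          have hl' : l + 1 ≤ k := Finset.mem_range.1 hl
          have a1 := hτ hl'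
          have a2 := hτ (Nat.le_of_succ_le hl')
          rw [min_eq_left a1, min_eq_left a2, min_eq_left (a1.trans ht), min_eq_left (a2.trans ht)]
        · intro l _ hl
          have hl' : k ≤ l := by simpa using hl
          rw [min_eq_right (hτ hl'), min_eq_right (hτ (hl'.trans (Nat.le_succ l)))]
          simp
      rw [e] at h
      have e2 : min (τ k) t = τ k := min_eq_left ht
      have h3 : 0 ≤ ∑ i, ϑ k i * s (min (τ (k+1)) t) i :=
        Finset.sum_nonneg fun i _ => mul_nonneg (h0 k hkn i) (hs _ i)
      simp only [e2, mul_sub, Finset.sum_sub_distrib] at h ⊢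
      linarith

lemma wealth_nonneg_ae {ℱ : MeasureTheory.Filtration ℝ≥0 m} {d : ℕ}
    (P : MeasureTheory.Measure Ω)
    (θ : SimpleStrategy ℱ d) (S : ℝ≥0 → Ω → Fin d → ℝ)
    (hS_nonneg : ∀ t ω i, 0 ≤ S t ω i) (x : ℝ) (hx : 0 ≤ x) (hθ : θ.Admissible P S x) :
    ∀ᵐ ω ∂P, ∀ t, 0 ≤ θ.wealth S x t ω := by
  have h : ∀ᵐ ω ∂P, ∀ j, j < θ.n → (∀ i, 0 ≤ θ.ϑ j ω i) ∧
    ∑ i, θ.ϑ j ω i * S (θ.τ j ω) ω i ≤ θ.wealth S x (θ.τ j ω) ω := by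
    rw [ae_all_iff]; intro j
    by_cases hj : j < θ.n
    · filter_upwards [hθ j hj] with ω hω _ using hω
    · exact Eventually.of_forall fun ω h => absurd h hj
  filter_upwards [h] with ω hω t
  exact wealth_nonneg_path θ.n (fun j => θ.τ j ω) (monotone_nat_of_le_succ fun j => θ.τ_mono j ω)
    (fun j => θ.ϑ j ω) (fun t => S t ω) (fun t i => hS_nonneg t ω i) x hx
    (fun j hj => (hω j hj).1) (fun j hj => (hω j hj).2) θ.n le_rfl t

/-- Halving a strategy. -/
def SimpleStrategy.half {ℱ : MeasureTheory.Filtration ℝ≥0 m} {d : ℕ}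
    (θ : SimpleStrategy ℱ d) : SimpleStrategy ℱ d where
  n := θ.n
  τ := θ.τ
  ϑ := fun j ω i => (1 / 2 : ℝ) * θ.ϑ j ω i
  τ_zero := θ.τ_zero
  τ_mono := θ.τ_mono
  τ_stopping := θ.τ_stopping
  ϑ_meas := fun j => by
    letI := (θ.τ_stopping j).measurableSpace
    exact measurable_pi_iff.2 fun i => (measurable_pi_iff.1 (θ.ϑ_meas j) i).const_mul _

lemma half_wealth {ℱ : MeasureTheory.Filtration ℝ≥0 m} {d : ℕ}
    (θ : SimpleStrategy ℱ d) (S : ℝ≥0 → Ω → Fin d → ℝ) (x : ℝ) (t : ℝ≥0) (ω : Ω) :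
    θ.half.wealth S x t ω = x / 2 + θ.wealth S x t ω / 2 := by
  simp only [SimpleStrategy.wealth, SimpleStrategy.half, mul_assoc, ← Finset.mul_sum]
  ring

lemma half_admissible {ℱ : MeasureTheory.Filtration ℝ≥0 m} {d : ℕ}
    (P : MeasureTheory.Measure Ω)
    (θ : SimpleStrategy ℱ d) (S : ℝ≥0 → Ω → Fin d → ℝ) (x : ℝ) (hx : 0 ≤ x)
    (hθ : θ.Admissible P S x) : θ.half.Admissible P S x := by
  intro j hj
  filter_upwards [hθ j hj] with ω hω
  refine ⟨fun i => mul_nonneg (by norm_num) (hω.1 i), ?_⟩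
  rw [half_wealth]
  have h := hω.2
  simp only [SimpleStrategy.half, mul_assoc, ← Finset.mul_sum]
  linarith

lemma erealPosPart_mono {a b : EReal} (h : a ≤ b) : erealPosPart a ≤ erealPosPart b := by
  unfold erealPosPart
  by_cases hb : b = ⊤
  · simp [hb]
  · have ha : a ≠ ⊤ := fun ha => hb (top_le_iff.1 (ha ▸ h))
    rw [if_neg ha, if_neg hb]
    by_cases ha' : a = ⊥
    · simp [ha']
    · exact ENNReal.ofReal_le_ofReal (EReal.toReal_le_toReal h ha' hb)

/-- Key estimate. -/
lemma key_estimate (P : MeasureTheory.Measure Ω) [IsProbabilityMeasure P]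
    (Y : Ω → ℝ) (A : Set Ω) (hA : MeasurableSet A) (U : ℝ → EReal)
    (hU_mono : ∀ a b : ℝ, 0 ≤ a → a ≤ b → U a ≤ U b) (a b : ℝ) (ha : 0 ≤ a) (hb : 0 ≤ b)
    (ha' : U a ≠ ⊥)
    (hY : ∀ᵐ ω ∂P, a ≤ Y ω) (hYA : ∀ ω ∈ A, b ≤ Y ω) (K : ℝ≥0)
    (hK : extExp P (fun ω => U (Y ω)) ≤ ((K : ℝ≥0∞) : EReal)) :
    erealPosPart (U b) * P A ≤ K + erealPosPart (-(U a)) := by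
  have h1 : erealPosPart (U b) * P A ≤ ∫⁻ ω, erealPosPart (U (Y ω)) ∂P := by
    rw [← setLIntegral_const]
    refine (setLIntegral_mono' hA fun ω hω => ?_).trans (setLIntegral_le_lintegral A _)
    exact erealPosPart_mono (hU_mono _ _ hb (hYA ω hω))
  have h2 : ∫⁻ ω, erealPosPart (-(U (Y ω))) ∂P ≤ erealPosPart (-(U a)) := by
    calc _ ≤ ∫⁻ _, erealPosPart (-(U a)) ∂P := by
          refine lintegral_mono_ae ?_
          filter_upwards [hY] with ω hω
          exact erealPosPart_mono (EReal.neg_le_neg_iff.2 (hU_mono _ _ ha hω))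
      _ = _ := by simp
  have hfin : erealPosPart (-(U a)) ≠ ⊤ := by
    unfold erealPosPart
    rw [if_neg (by simpa using ha')]
    exact ENNReal.ofReal_ne_top
  refine h1.trans ?_
  unfold extExp at hK
  have h3 : ((∫⁻ ω, erealPosPart (U (Y ω)) ∂P : ℝ≥0∞) : EReal) ≤
      ((K : ℝ≥0∞) : EReal) + ((∫⁻ ω, erealPosPart (-(U (Y ω))) ∂P : ℝ≥0∞) : EReal) := by
    have hne : (∫⁻ ω, erealPosPart (-(U (Y ω))) ∂P) ≠ ⊤ := ne_top_of_le_ne_top hfin h2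
    refine (EReal.sub_le_iff_le_add ?_ ?_).1 hK
    · left; simp
    · left; simpa using hne
  rw [← EReal.coe_ennreal_add, EReal.coe_ennreal_le_coe_ennreal_iff] at h3
  exact h3.trans (by gcongr)

/-- **Proposition 3.1 (key step).** If the expected utility of terminal wealths over
`𝒳_s(x)` is bounded above, then `{X_T : X ∈ 𝒳_s(x)}` is bounded in probability. Here
`U : [0,∞) → ℝ ∪ {−∞}` is nondecreasing with `U > −∞` on `(0,∞)` and `U(∞) = ∞`, and `T` is a
finite stopping time. -/
theorem bddInProb_of_finite_expected_utility
    {Ω : Type*} {m : MeasurableSpace Ω} (P : MeasureTheory.Measure Ω)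
    [MeasureTheory.IsProbabilityMeasure P] (ℱ : MeasureTheory.Filtration ℝ≥0 m)
    (hright : RightContinuousFiltration ℱ) (hcompl : CompleteFiltration ℱ P)
    (d : ℕ) (S : ℝ≥0 → Ω → Fin d → ℝ)
    (hS_adapted : MeasureTheory.StronglyAdapted ℱ S)
    (hS_cadlag : ∀ ω, IsCadlag (fun t => S t ω))
    (hS_nonneg : ∀ t ω i, 0 ≤ S t ω i)
    (U : ℝ → EReal)
    (hU_mono : ∀ a b : ℝ, 0 ≤ a → a ≤ b → U a ≤ U b)
    (hU_ne_bot : ∀ y : ℝ, 0 < y → U y ≠ ⊥)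
    (hU_ne_top : ∀ y : ℝ, U y ≠ ⊤)
    (hU_infty : Filter.Tendsto U Filter.atTop (nhds (⊤ : EReal)))
    (x : ℝ) (hx : 0 < x)
    (T : Ω → ℝ≥0) (hT : MeasureTheory.IsStoppingTime ℱ (fun ω => (T ω : WithTop ℝ≥0)))
    (hfin : (⨆ X ∈ Xs P ℱ S x, extExp P (fun ω => U (X (T ω) ω))) < ⊤) :
    BddInProb P ((fun X : ℝ≥0 → Ω → ℝ => fun ω => X (T ω) ω) '' Xs P ℱ S x) := by
  have hSm : ∀ t, Measurable (S t) := fun t => ((hS_adapted t).mono (ℱ.le t)).measurable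
  have hTm := measurable_of_stopping T hT
  obtain ⟨K, hK⟩ : ∃ K : ℝ≥0, (⨆ X ∈ Xs P ℱ S x, extExp P (fun ω => U (X (T ω) ω)))
      ≤ ((K : ℝ≥0∞) : EReal) := by
    obtain ⟨r, hr1, -⟩ := EReal.lt_iff_exists_real_btwn.1 hfin
    refine ⟨r.toNNReal, hr1.le.trans ?_⟩
    rw [show ((r.toNNReal : ℝ≥0∞) : EReal) = ((r.toNNReal : ℝ) : EReal) from rfl]
    exact EReal.coe_le_coe_iff.2 (Real.le_coe_toNNReal r)
  have hx2 : 0 < x / 2 := by linarith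
  set M : ℝ≥0∞ := K + erealPosPart (-(U (x / 2))) with hM
  have hMfin : M ≠ ⊤ := by
    refine ENNReal.add_ne_top.2 ⟨ENNReal.coe_ne_top, ?_⟩
    unfold erealPosPart
    rw [if_neg (by simpa using hU_ne_bot _ hx2)]
    exact ENNReal.ofReal_ne_top
  have main : ∀ ℓ : ℝ, 0 ≤ ℓ → ∀ X ∈ Xs P ℱ S x,
      erealPosPart (U (ℓ / 2)) * P {ω | ℓ < |X (T ω) ω|} ≤ M := by
    rintro ℓ hℓ X ⟨θ, hθ, rfl⟩
    have hnn := wealth_nonneg_ae P θ S hS_nonneg x hx.le hθ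
    have hm := wealth_measurable θ S hSm hS_cadlag x T hTm
    have hle : P {ω | ℓ < |θ.wealth S x (T ω) ω|} ≤ P {ω | ℓ < θ.wealth S x (T ω) ω} := by
      refine measure_mono_ae ?_
      filter_upwards [hnn] with ω hω h
      have h' : ℓ < |θ.wealth S x (T ω) ω| := h
      rw [abs_of_nonneg (hω _)] at h'
      exact h'
    refine (mul_le_mul_right hle _).trans ?_
    refine key_estimate P (fun ω => θ.half.wealth S x (T ω) ω) _
      (measurableSet_lt measurable_const hm) U hU_mono (x / 2) (ℓ / 2) hx2.le (by linarith)
      (hU_ne_bot _ hx2) ?_ ?_ K ?_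
    · filter_upwards [hnn] with ω hω
      have := hω (T ω)
      rw [half_wealth]; linarith
    · intro ω hω
      have h' : ℓ < θ.wealth S x (T ω) ω := hω
      show ℓ / 2 ≤ θ.half.wealth S x (T ω) ω
      rw [half_wealth]; linarith
    · refine le_trans ?_ hK
      exact le_iSup₂ (f := fun X (_ : X ∈ Xs P ℱ S x) => extExp P (fun ω => U (X (T ω) ω)))
        (θ.half.wealth S x) ⟨θ.half, half_admissible P θ S x hx.le hθ, rfl⟩
  unfold BddInProb
  rw [ENNReal.tendsto_nhds_zero]
  intro ε hε
  by_cases hεt : ε = ⊤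
  · simp [hεt]
  have hq : M / ε + 1 ≠ ⊤ :=
    ENNReal.add_ne_top.2 ⟨ENNReal.div_ne_top hMfin hε.ne', ENNReal.one_ne_top⟩
  have hev : ∀ᶠ ℓ : ℝ in atTop, (((M / ε + 1).toReal : ℝ) : EReal) < U (ℓ / 2) :=
    (EReal.tendsto_nhds_top_iff_real.1 (hU_infty.comp
      (tendsto_id.atTop_div_const (by norm_num : (0:ℝ) < 2)))) _
  filter_upwards [hev, eventually_ge_atTop 0] with ℓ hℓ h0
  refine iSup₂_le ?_
  rintro f ⟨X, hX, rfl⟩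
  have h1 := main ℓ h0 X hX
  have h2 : M / ε + 1 ≤ erealPosPart (U (ℓ / 2)) := by
    refine le_trans ?_ (erealPosPart_mono hℓ.le)
    simp only [erealPosPart, EReal.coe_ne_top, if_false, EReal.toReal_coe]
    rw [ENNReal.ofReal_toReal hq]
  have h3 : (M / ε + 1) * P {ω | ℓ < |X (T ω) ω|} ≤ M := (mul_le_mul_left h2 _).trans h1
  have h4 : P {ω | ℓ < |X (T ω) ω|} ≤ M / (M / ε + 1) :=
    (ENNReal.le_div_iff_mul_le (Or.inl (by simp)) (Or.inl hq)).2 (by rwa [mul_comm])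
  refine h4.trans (ENNReal.div_le_of_le_mul ?_)
  calc M = ε * (M / ε) := (ENNReal.mul_div_cancel hε.ne' hεt).symm
    _ ≤ ε * (M / ε + 1) := by gcongr; exact le_self_add

end
end
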